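/- One has 6 ∣ v_6 while 2 ∤ v_2 and 3 ∤ v_3 (i.e., 6 ∈ T but 2 ∉ T and 3 ∉ T) if and only if P ≡ 1 or 5 (mod 6) and Q ≡ 5 (mod 6). -/

import Mathlib

/-- Lucas sequence of the second kind: `v 0 = 2`, `v 1 = P`,
`v (n+2) = P * v (n+1) - Q * v n`. -/
def lucasV (P Q : ℤ) : ℕ → ℤ
  | 0 => 2
  | 1 => P
  | n + 2 => P * lucasV P Q (n + 1) - Q * lucasV P Q n

/-- Congruent parameters give congruent Lucas sequences of the second kind. -/
theorem lucasV_modEq {m P P' Q Q' : ℤ} (hP : P ≡ P' [ZMOD m]) (hQ : Q ≡ Q' [ZMOD m]) (n : ℕ) :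
    lucasV P Q n ≡ lucasV P' Q' n [ZMOD m] := by
  induction n using Nat.twoStepInduction with
  | zero => rfl
  | one => exact hP
  | more n ih₀ ih₁ => exact (hP.mul ih₁).sub (hQ.mul ih₀)

/-- Divisibility of a Lucas number by a divisor of `m` depends only on the parameters mod `m`. -/
theorem dvd_lucasV_iff_emod {d m : ℤ} (hd : d ∣ m) (P Q : ℤ) (n : ℕ) :
    d ∣ lucasV P Q n ↔ d ∣ lucasV (P % m) (Q % m) n := by
  have h := (lucasV_modEq (Int.mod_modEq P m) (Int.mod_modEq Q m) n).dvd
  exact dvd_iff_dvd_of_dvd_sub (hd.trans h)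

/-- `6 ∈ T`, `2 ∉ T`, `3 ∉ T` iff `P ≡ ±1 (mod 6)` and `Q ≡ -1 (mod 6)`. -/
theorem six_basic_T_iff (P Q : ℤ) :
    ((6 : ℤ) ∣ lucasV P Q 6 ∧ ¬ (2 : ℤ) ∣ lucasV P Q 2 ∧ ¬ (3 : ℤ) ∣ lucasV P Q 3) ↔
      ((P % 6 = 1 ∨ P % 6 = 5) ∧ Q % 6 = 5) := by
  rw [dvd_lucasV_iff_emod (dvd_refl 6), dvd_lucasV_iff_emod (m := 6) (d := 2) (by norm_num),
    dvd_lucasV_iff_emod (m := 6) (d := 3) (by norm_num)]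
  have hP₀ : 0 ≤ P % 6 := Int.emod_nonneg P (by norm_num)
  have hP₁ : P % 6 < 6 := Int.emod_lt_of_pos P (by norm_num)
  have hQ₀ : 0 ≤ Q % 6 := Int.emod_nonneg Q (by norm_num)
  have hQ₁ : Q % 6 < 6 := Int.emod_lt_of_pos Q (by norm_num)
  generalize P % 6 = p at *
  generalize Q % 6 = q at *
  interval_cases p <;> interval_cases q <;> norm_num [lucasV]
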